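/- For ν ∈ [-1/2, 1) and x > 0 one has G′_{ν,1}(x)/G′_{ν,2}(x) = ν²(1+x) / ((1 + (1+2ν)x/3)(1 + (1−ν)x/3)). Moreover, for ν ∈ (−1/2, 0) ∪ (0, 1), setting x_* = √((4+2ν)/(1+2ν)) − 1 > 0, this quotient is strictly increasing on (0, x_*) and strictly decreasing on (x_*, ∞). -/

import Mathlib

/-- Numerator `G_{ν,1}` of the one-variable quotient. -/
noncomputable def G1 (ν x : ℝ) : ℝ :=
  3 * Real.log (1 + x/3) - Real.log (1 + (1+2*ν)*x/3) - 2 * Real.log (1 + (1-ν)*x/3)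

/-- Denominator `G_{ν,2}` of the one-variable quotient (independent of `ν`). -/
noncomputable def G2 (x : ℝ) : ℝ :=
  3 * Real.log (1 + x/3) - Real.log (1 + x)

theorem hasDerivAt_log_one_add_mul_div (c x : ℝ) (h : 1 + c * x / 3 ≠ 0) :
    HasDerivAt (fun y : ℝ => Real.log (1 + c * y / 3)) (c / 3 / (1 + c * x / 3)) x := by
  have h1 : HasDerivAt (fun y : ℝ => 1 + c * y / 3) (c / 3) x := by
    simpa using (((hasDerivAt_id x).const_mul c).div_const 3).const_add 1
  exact h1.log h

theorem hasDerivAt_log_one_add_div_three {x : ℝ} (hx : 0 < x) :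
    HasDerivAt (fun y : ℝ => Real.log (1 + y / 3)) (1 / 3 / (1 + x / 3)) x := by
  simpa using hasDerivAt_log_one_add_mul_div 1 x (by positivity)

theorem deriv_G2 {x : ℝ} (hx : 0 < x) :
    deriv G2 x = (2 * x / 3) / ((1 + x / 3) * (1 + x)) := by
  have h : HasDerivAt (fun y : ℝ => Real.log (1 + y)) (1 / (1 + x)) x :=
    ((hasDerivAt_id x).const_add 1).log (by simp only [id]; positivity)
  have h2 : HasDerivAt G2 (3 * (1 / 3 / (1 + x / 3)) - 1 / (1 + x)) x :=
    ((hasDerivAt_log_one_add_div_three hx).const_mul 3).sub h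
  rw [h2.deriv]
  field_simp
  ring

theorem deriv_G1 {ν x : ℝ} (hx : 0 < x) (hA : 0 < 1 + (1+2*ν)*x/3) (hB : 0 < 1 + (1-ν)*x/3) :
    deriv (G1 ν) x =
      ν^2 * (2 * x / 3) / ((1 + x / 3) * ((1 + (1+2*ν)*x/3) * (1 + (1-ν)*x/3))) := by
  have h : HasDerivAt (G1 ν) (3 * (1 / 3 / (1 + x / 3))
      - (1+2*ν) / 3 / (1 + (1+2*ν)*x/3) - 2 * ((1-ν) / 3 / (1 + (1-ν)*x/3))) x :=
    (((hasDerivAt_log_one_add_div_three hx).const_mul 3).sub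
      (hasDerivAt_log_one_add_mul_div (1+2*ν) x hA.ne')).sub
      ((hasDerivAt_log_one_add_mul_div (1-ν) x hB.ne').const_mul 2)
  rw [h.deriv]
  have hC : 1 + x / 3 ≠ 0 := by positivity
  rw [div_div, div_div, div_div, eq_div_iff (by positivity)]
  have e1 : (3 * (1 / (3 * (1 + x / 3)))) = 1 / (1 + x / 3) := by field_simp
  rw [e1]
  generalize hA' : 1 + (1+2*ν)*x/3 = A at *
  generalize hB' : 1 + (1-ν)*x/3 = B at *
  generalize hC' : 1 + x / 3 = C at *
  field_simp
  subst hA' hB' hC'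
  ring

theorem deriv_G1_div_deriv_G2 {ν x : ℝ} (hν1 : -1/2 ≤ ν) (hν2 : ν < 1) (hx : 0 < x) :
    deriv (G1 ν) x / deriv G2 x
      = ν^2 * (1+x) / ((1 + (1+2*ν)*x/3) * (1 + (1-ν)*x/3)) := by
  have ha : 0 ≤ 1 + 2 * ν := by linarith
  have hb : 0 < 1 - ν := by linarith
  have hA : 0 < 1 + (1+2*ν)*x/3 := by positivity
  have hB : 0 < 1 + (1-ν)*x/3 := by positivity
  rw [deriv_G1 hx hA hB, deriv_G2 hx]
  generalize 1 + (1+2*ν)*x/3 = A at *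
  generalize 1 + (1-ν)*x/3 = B at *
  field_simp

/-- The cross difference deciding which of two values of the quotient is larger. -/
theorem quotient_cross_difference (ν x y : ℝ) :
    (1+y) * ((1 + (1+2*ν)*x/3) * (1 + (1-ν)*x/3))
      - (1+x) * ((1 + (1+2*ν)*y/3) * (1 + (1-ν)*y/3))
      = (y - x) * (1 - ν) * ((4 + 2*ν) - (1+2*ν) * ((1+x) * (1+y))) / 9 := by
  ring

theorem stmt_19 (ν : ℝ) (hν1 : -1/2 ≤ ν) (hν2 : ν < 1) :
    (∀ x : ℝ, 0 < x →
      deriv (G1 ν) x / deriv G2 x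
        = ν^2 * (1+x) / ((1 + (1+2*ν)*x/3) * (1 + (1-ν)*x/3))) ∧
    (-1/2 < ν → ν ≠ 0 →
      0 < Real.sqrt ((4+2*ν)/(1+2*ν)) - 1 ∧
      StrictMonoOn (fun x => deriv (G1 ν) x / deriv G2 x)
        (Set.Ioo 0 (Real.sqrt ((4+2*ν)/(1+2*ν)) - 1)) ∧
      StrictAntiOn (fun x => deriv (G1 ν) x / deriv G2 x)
        (Set.Ioi (Real.sqrt ((4+2*ν)/(1+2*ν)) - 1))) := by
  refine ⟨fun x hx => deriv_G1_div_deriv_G2 hν1 hν2 hx, fun hν hν0 => ?_⟩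
  have ha : 0 < 1 + 2 * ν := by linarith
  have hb : 0 < 1 - ν := by linarith
  have hT1 : 1 < Real.sqrt ((4+2*ν)/(1+2*ν)) := by
    rw [Real.lt_sqrt zero_le_one, lt_div_iff₀ ha]
    linarith
  have hT : (1+2*ν) * Real.sqrt ((4+2*ν)/(1+2*ν)) ^ 2 = 4 + 2*ν := by
    rw [Real.sq_sqrt (div_nonneg (by linarith) ha.le)]
    field_simp
  generalize Real.sqrt ((4+2*ν)/(1+2*ν)) = T at *
  have hν_sq : 0 < ν^2 := by positivity
  refine ⟨by linarith, ?_, ?_⟩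
  · rintro x ⟨hx, hxT⟩ y ⟨hy, hyT⟩ hxy
    simp only [deriv_G1_div_deriv_G2 hν1 hν2 hx, deriv_G1_div_deriv_G2 hν1 hν2 hy]
    rw [mul_div_assoc (ν^2), mul_div_assoc (ν^2)]
    refine mul_lt_mul_of_pos_left ?_ hν_sq
    rw [div_lt_div_iff₀ (by positivity) (by positivity), ← sub_pos, quotient_cross_difference]
    have hprod : (1+x) * (1+y) < T^2 := by nlinarith
    have := mul_lt_mul_of_pos_left hprod ha
    exact div_pos (mul_pos (mul_pos (by linarith) hb) (by linarith)) (by norm_num)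
  · intro x hxT y hyT hxy
    rw [Set.mem_Ioi] at hxT hyT
    have hx : 0 < x := by linarith
    have hy : 0 < y := by linarith
    simp only [deriv_G1_div_deriv_G2 hν1 hν2 hx, deriv_G1_div_deriv_G2 hν1 hν2 hy]
    rw [mul_div_assoc (ν^2), mul_div_assoc (ν^2)]
    refine mul_lt_mul_of_pos_left ?_ hν_sq
    rw [div_lt_div_iff₀ (by positivity) (by positivity), ← sub_neg, quotient_cross_difference]
    have hprod : T^2 < (1+x) * (1+y) := by nlinarith
    have := mul_lt_mul_of_pos_left hprod ha
    exact div_neg_of_neg_of_pos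
      (mul_neg_of_pos_of_neg (mul_pos (by linarith) hb) (by linarith)) (by norm_num)
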